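/- arXiv:2010.14349 — 2 statements merged into one kernel-verified Lean document; each statement's English description precedes it below -/
import Mathlib

section
/- The star chromatic index of the necklace N_3 equals 5. -/
/-- A star `k`-edge-coloring of `G`: a proper edge-coloring (adjacent edges get
distinct colors) such that no path and no cycle with exactly four edges is
bicolored.  The walks `v₀v₁v₂v₃v₄` with consecutive vertices adjacent and with
`v₀,v₁,v₂,v₃` pairwise distinct and `v₁,v₂,v₃,v₄` pairwise distinct are exactly
the paths (when `v₀ ≠ v₄`) and cycles (when `v₀ = v₄`) with four edges; being
bicolored under a proper coloring means the colors alternate. -/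
def IsStarEdgeColoring {V : Type*} (G : SimpleGraph V) {k : ℕ} (c : Sym2 V → Fin k) : Prop :=
  (∀ ⦃u v w : V⦄, G.Adj u v → G.Adj u w → v ≠ w → c s(u, v) ≠ c s(u, w)) ∧
  (∀ v₀ v₁ v₂ v₃ v₄ : V, G.Adj v₀ v₁ → G.Adj v₁ v₂ → G.Adj v₂ v₃ → G.Adj v₃ v₄ →
    v₀ ≠ v₂ → v₀ ≠ v₃ → v₁ ≠ v₃ → v₁ ≠ v₄ → v₂ ≠ v₄ →
    ¬(c s(v₀, v₁) = c s(v₂, v₃) ∧ c s(v₁, v₂) = c s(v₃, v₄)))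

/-- The star chromatic index of `G`: the least `k` such that `G` admits a
star `k`-edge-coloring. -/
noncomputable def starChromaticIndex {V : Type*} (G : SimpleGraph V) : ℕ :=
  sInf {k : ℕ | ∃ c : Sym2 V → Fin k, IsStarEdgeColoring G c}

/-- The adjacency relation of the necklace `N_h`.  `Sum.inl i` is the spine
vertex `s_{i+1}` (for `0 ≤ i ≤ h-1`) and `Sum.inr j` is the cycle vertex `ℓ_j`
(for `0 ≤ j ≤ h+1`).  Edges: spine edges `s_i s_{i+1}`, the tree edges
`s_1 ℓ_0`, `s_h ℓ_{h+1}`, `s_i ℓ_i`, and the cycle edges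
`ℓ_0 ℓ_1, …, ℓ_h ℓ_{h+1}, ℓ_{h+1} ℓ_0`. -/
def necklaceRel (h : ℕ) : (Fin h ⊕ Fin (h + 2)) → (Fin h ⊕ Fin (h + 2)) → Prop
  | Sum.inl i, Sum.inl j => (j : ℕ) = (i : ℕ) + 1
  | Sum.inl i, Sum.inr j =>
      ((i : ℕ) = 0 ∧ (j : ℕ) = 0) ∨ ((i : ℕ) + 1 = h ∧ (j : ℕ) = h + 1) ∨
        ((j : ℕ) = (i : ℕ) + 1)
  | Sum.inr i, Sum.inr j => (j : ℕ) = ((i : ℕ) + 1) % (h + 2)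
  | Sum.inr _, Sum.inl _ => False

/-- The necklace `N_h`, a cubic Halin graph on `2h + 2` vertices. -/
def necklace (h : ℕ) : SimpleGraph (Fin h ⊕ Fin (h + 2)) :=
  SimpleGraph.fromRel (necklaceRel h)

instance (h : ℕ) : DecidableRel (necklaceRel h)
  | Sum.inl i, Sum.inl j => inferInstanceAs (Decidable ((j : ℕ) = (i : ℕ) + 1))
  | Sum.inl i, Sum.inr j => inferInstanceAs (Decidable (((i : ℕ) = 0 ∧ (j : ℕ) = 0) ∨
      ((i : ℕ) + 1 = h ∧ (j : ℕ) = h + 1) ∨ ((j : ℕ) = (i : ℕ) + 1)))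
  | Sum.inr i, Sum.inr j => inferInstanceAs (Decidable ((j : ℕ) = ((i : ℕ) + 1) % (h + 2)))
  | Sum.inr _, Sum.inl _ => inferInstanceAs (Decidable False)

instance (h : ℕ) : DecidableRel (necklace h).Adj :=
  inferInstanceAs (DecidableRel (SimpleGraph.fromRel (necklaceRel h)).Adj)

/-- A star edge-coloring stays one after an injective renaming of the colors. -/
theorem IsStarEdgeColoring.comp_injective {V : Type*} {G : SimpleGraph V} {k m : ℕ}
    {c : Sym2 V → Fin k} (hc : IsStarEdgeColoring G c) {f : Fin k → Fin m}
    (hf : Function.Injective f) : IsStarEdgeColoring G (f ∘ c) := by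
  refine ⟨fun u v w huv huw hvw h => hc.1 huv huw hvw (hf h), ?_⟩
  intro v₀ v₁ v₂ v₃ v₄ h₁ h₂ h₃ h₄ h₀₂ h₀₃ h₁₃ h₁₄ h₂₄ h
  exact hc.2 v₀ v₁ v₂ v₃ v₄ h₁ h₂ h₃ h₄ h₀₂ h₀₃ h₁₃ h₁₄ h₂₄ ⟨hf h.1, hf h.2⟩

/-- Two colors out of four that both avoid three distinct colors coincide. -/
theorem Fin.eq_of_avoid_three : ∀ a b t : Fin 4, a ≠ b → a ≠ t → b ≠ t →
    ∀ p r : Fin 4, a ≠ p → b ≠ p → t ≠ p → a ≠ r → b ≠ r → t ≠ r → p = r := by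
  decide

/-- The house, a triangle `x y z` and a four-cycle `y z v u` sharing the edge `y z`, has no
star 4-edge-coloring.  The colors are `a = xy`, `b = xz`, `t = yz`, `p = yu`, `q = zv`,
`r = uv`. -/
theorem house_not_star_four_edge_colorable (a b : Fin 4) (hab : a ≠ b) (t : Fin 4)
    (hat : a ≠ t) (hbt : b ≠ t) (p : Fin 4) (hap : a ≠ p) (htp : t ≠ p) (q : Fin 4)
    (hbq : b ≠ q) (htq : t ≠ q) (r : Fin 4) (hpr : p ≠ r) (hqr : q ≠ r)
    (hpq : p = q → a ≠ r ∧ b ≠ r ∧ t ≠ r) (hpb : p = b → a ≠ q ∧ a ≠ r ∧ t ≠ r)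
    (hqa : q = a → b ≠ r ∧ t ≠ r) : False := by
  have key := Fin.eq_of_avoid_three a b t hab hat hbt
  by_cases h : p = b
  · obtain ⟨haq, har, htr⟩ := hpb h
    exact hqr (key q r haq hbq htq har (h ▸ hpr) htr)
  by_cases h' : q = a
  · obtain ⟨hbr, htr⟩ := hqa h'
    exact hpr (key p r hap (Ne.symm h) htp (h' ▸ hqr) hbr htr)
  · obtain ⟨har, hbr, htr⟩ := hpq (key p q hap (Ne.symm h) htp (Ne.symm h') hbq htq)
    exact hpr (key p r hap (Ne.symm h) htp har hbr htr)

/-- A graph containing a house has no star edge-coloring with at most four colors. -/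
theorem IsStarEdgeColoring.four_lt_of_house {V : Type*} {G : SimpleGraph V} {k : ℕ}
    {c : Sym2 V → Fin k} (hc : IsStarEdgeColoring G c) {x y z u v : V}
    (hxy : G.Adj x y) (hxz : G.Adj x z) (hyz : G.Adj y z) (hyu : G.Adj y u) (hzv : G.Adj z v)
    (huv : G.Adj u v) (hxu : x ≠ u) (hxv : x ≠ v) (hyv : y ≠ v) (hzu : z ≠ u) : 4 < k := by
  by_contra! hk
  obtain ⟨hprop, hstar⟩ := hc.comp_injective (Fin.castLE_injective hk)
  generalize Fin.castLE hk ∘ c = d at hprop hstar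
  have swap (w w' : V) : d s(w, w') = d s(w', w) := by rw [Sym2.eq_swap]
  refine house_not_star_four_edge_colorable (d s(x, y)) (d s(x, z)) ?_ (d s(y, z)) ?_ ?_
    (d s(y, u)) ?_ ?_ (d s(z, v)) ?_ ?_ (d s(u, v)) ?_ ?_ ?_ ?_ ?_
  · exact hprop hxy hxz hyz.ne
  · exact swap x y ▸ hprop hxy.symm hyz hxz.ne
  · exact swap x z ▸ swap y z ▸ hprop hxz.symm hyz.symm hxy.ne
  · exact swap x y ▸ hprop hxy.symm hyu hxu
  · exact hprop hyz hyu hzu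
  · exact swap x z ▸ hprop hxz.symm hzv hxv
  · exact swap y z ▸ hprop hyz.symm hzv hyv
  · exact swap y u ▸ hprop hyu.symm huv hyv
  · exact swap z v ▸ swap u v ▸ hprop hzv.symm huv.symm hzu
  · have h₁ := hstar x y u v z hxy hyu huv hzv.symm
    have h₂ := hstar y u v z x hyu huv hzv.symm hxz.symm
    have h₃ := hstar y u v z y hyu huv hzv.symm hyz.symm
    grind [SimpleGraph.Adj.ne, SimpleGraph.Adj.symm]
  · have h₁ := hstar u y x z v hyu.symm hxy.symm hxz hzv
    have h₂ := hstar z x y u v hxz.symm hxy hyu huv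
    have h₃ := hstar x z y u v hxz hyz.symm hyu huv
    grind [SimpleGraph.Adj.ne, SimpleGraph.Adj.symm]
  · have h₁ := hstar y x z v u hxy.symm hxz hzv huv.symm
    have h₂ := hstar u v z y x huv hzv.symm hyz.symm hxy.symm
    grind [SimpleGraph.Adj.ne, SimpleGraph.Adj.symm]

/-- A star 5-edge-coloring of the necklace `N₃`. -/
def necklaceThreeColoring : Sym2 (Fin 3 ⊕ Fin 5) → Fin 5 :=
  fun e =>
    if e ∈ [s(Sum.inl 0, Sum.inr 0), s(Sum.inr 2, Sum.inr 3)] then 0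
    else if e ∈ [s(Sum.inl 0, Sum.inr 1), s(Sum.inl 2, Sum.inr 4)] then 1
    else if e ∈ [s(Sum.inr 0, Sum.inr 1), s(Sum.inl 0, Sum.inl 1), s(Sum.inl 2, Sum.inr 3)] then 2
    else if e ∈ [s(Sum.inr 1, Sum.inr 2), s(Sum.inr 0, Sum.inr 4), s(Sum.inl 1, Sum.inl 2)] then 3
    else 4

theorem isStarEdgeColoring_necklaceThreeColoring :
    IsStarEdgeColoring (necklace 3) necklaceThreeColoring := by
  constructor
  · have h : ∀ u v, (necklace 3).Adj u v → ∀ w, (necklace 3).Adj u w → v ≠ w →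
        necklaceThreeColoring s(u, v) ≠ necklaceThreeColoring s(u, w) := by decide
    exact fun u v w huv huw => h u v huv w huw
  · have h : ∀ v₀ v₁, (necklace 3).Adj v₀ v₁ → ∀ v₂, (necklace 3).Adj v₁ v₂ → v₀ ≠ v₂ →
        ∀ v₃, (necklace 3).Adj v₂ v₃ → v₀ ≠ v₃ → v₁ ≠ v₃ →
        necklaceThreeColoring s(v₀, v₁) = necklaceThreeColoring s(v₂, v₃) →
        ∀ v₄, (necklace 3).Adj v₃ v₄ → v₁ ≠ v₄ → v₂ ≠ v₄ →
        necklaceThreeColoring s(v₁, v₂) ≠ necklaceThreeColoring s(v₃, v₄) := by decide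
    exact fun v₀ v₁ v₂ v₃ v₄ h₁ h₂ h₃ h₄ h₀₂ h₀₃ h₁₃ h₁₄ h₂₄ e =>
      h v₀ v₁ h₁ v₂ h₂ h₀₂ v₃ h₃ h₀₃ h₁₃ e.1 v₄ h₄ h₁₄ h₂₄ e.2

/-- The star chromatic index of the necklace `N₃` equals 5. -/
theorem starChromaticIndex_necklace_three : starChromaticIndex (necklace 3) = 5 := by
  refine IsLeast.csInf_eq ⟨⟨necklaceThreeColoring, isStarEdgeColoring_necklaceThreeColoring⟩, ?_⟩
  rintro k ⟨c, hc⟩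
  exact hc.four_lt_of_house (x := Sum.inr 0) (y := Sum.inl 0) (z := Sum.inr 1) (u := Sum.inl 1)
    (v := Sum.inr 2) (by decide) (by decide) (by decide) (by decide) (by decide) (by decide)
    (by decide) (by decide) (by decide) (by decide)
end

section
/- For every integer n ≥ 2, the star chromatic index of the generalized Petersen graph P(3n, n) equals 5. -/
/-- The adjacency relation of the generalized Petersen graph `P(m, n)`:
`Sum.inl i` is the outer vertex `uᵢ` and `Sum.inr i` is the inner vertex `vᵢ`,
with edges `uᵢ uᵢ₊₁`, `uᵢ vᵢ` and `vᵢ vᵢ₊ₙ`, indices modulo `m`. -/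
def genPetersenRel (m n : ℕ) : (ZMod m ⊕ ZMod m) → (ZMod m ⊕ ZMod m) → Prop
  | Sum.inl i, Sum.inl j => j = i + 1
  | Sum.inl i, Sum.inr j => i = j
  | Sum.inr i, Sum.inr j => j = i + (n : ZMod m)
  | Sum.inr _, Sum.inl _ => False

/-- The generalized Petersen graph `P(m, n)` on `2m` vertices. -/
def genPetersen (m n : ℕ) : SimpleGraph (ZMod m ⊕ ZMod m) :=
  SimpleGraph.fromRel (genPetersenRel m n)

open Sum

theorem genPetersen_adj_inl {m n : ℕ} (h1 : (1 : ZMod m) ≠ 0) (i : ZMod m)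
    (y : ZMod m ⊕ ZMod m) : (genPetersen m n).Adj (inl i) y ↔
      y = inl (i + 1) ∨ y = inl (i - 1) ∨ y = inr i := by
  rcases y with j | j
  · simp only [genPetersen, SimpleGraph.fromRel_adj, genPetersenRel, ne_eq, inl.injEq, reduceCtorEq]
    grind
  · simp [genPetersen, SimpleGraph.fromRel_adj, genPetersenRel, eq_comm]

theorem genPetersen_adj_inr {m n : ℕ} (hn : (n : ZMod m) ≠ 0) (i : ZMod m)
    (y : ZMod m ⊕ ZMod m) : (genPetersen m n).Adj (inr i) y ↔
      y = inr (i + n) ∨ y = inr (i - n) ∨ y = inl i := by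
  rcases y with j | j
  · simp [genPetersen, SimpleGraph.fromRel_adj, genPetersenRel]
  · simp only [genPetersen, SimpleGraph.fromRel_adj, genPetersenRel, ne_eq, inr.injEq, reduceCtorEq]
    grind

/-! ### Lower bound -/

theorem five_le_of_ne {k : ℕ} {a b c d e : Fin k} (hab : a ≠ b) (hac : a ≠ c) (had : a ≠ d)
    (hae : a ≠ e) (hbc : b ≠ c) (hbd : b ≠ d) (hbe : b ≠ e) (hcd : c ≠ d) (hce : c ≠ e)
    (hde : d ≠ e) : 5 ≤ k := by
  omega

/-- If a vertex `a` of a triangle `a b d` has a further neighbour `u`, and `u` has two further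
neighbours `x`, `y` whose edges avoid the colors of `ab` and `ad`, then there are five colors. -/
theorem IsStarEdgeColoring.five_le_of_avoid {V : Type*} {G : SimpleGraph V} {k : ℕ}
    {c : Sym2 V → Fin k} (hc : IsStarEdgeColoring G c) {a b d u x y : V} (hab : G.Adj a b)
    (had : G.Adj a d) (hau : G.Adj a u) (hux : G.Adj u x) (huy : G.Adj u y) (hbd : b ≠ d)
    (hub : u ≠ b) (hud : u ≠ d) (hxy : x ≠ y) (hax : a ≠ x) (hay : a ≠ y)
    (havoid : ∀ z, z = x ∨ z = y → c s(u, z) ≠ c s(a, b) ∧ c s(u, z) ≠ c s(a, d)) : 5 ≤ k := by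
  have hx := havoid x (.inl rfl)
  have hy := havoid y (.inr rfl)
  have h1 := hc.1 hux huy hxy
  have h2 := hc.1 hau.symm hux hax
  have h3 := hc.1 hau.symm huy hay
  rw [Sym2.eq_swap] at h2 h3
  exact five_le_of_ne (hc.1 hab had hbd) (hc.1 hab hau hub.symm) hx.1.symm hy.1.symm
    (hc.1 had hau hud.symm) hx.2.symm hy.2.symm h2 h3 h1

/-- If an edge leaving a triangle `a b d` at `a` has the color of the opposite side `bd`, there are
at least five colors. -/
theorem IsStarEdgeColoring.five_le_of_eq_opposite {V : Type*} {G : SimpleGraph V} {k : ℕ}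
    {c : Sym2 V → Fin k} (hc : IsStarEdgeColoring G c) {a b d u x y : V} (hab : G.Adj a b)
    (had : G.Adj a d) (hbd : G.Adj b d) (hau : G.Adj a u) (hux : G.Adj u x) (huy : G.Adj u y)
    (hub : u ≠ b) (hud : u ≠ d) (hxy : x ≠ y) (hax : a ≠ x) (hay : a ≠ y)
    (hbx : b ≠ x) (hby : b ≠ y) (hdx : d ≠ x) (hdy : d ≠ y)
    (h : c s(a, u) = c s(b, d)) : 5 ≤ k := by
  refine hc.five_le_of_avoid hab had hau hux huy hbd.ne hub hud hxy hax hay fun z hz ↦ ?_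
  have huz : G.Adj u z := by rcases hz with rfl | rfl <;> assumption
  have haz : a ≠ z := by rcases hz with rfl | rfl <;> assumption
  have hbz : b ≠ z := by rcases hz with rfl | rfl <;> assumption
  have hdz : d ≠ z := by rcases hz with rfl | rfl <;> assumption
  have h1 := hc.2 z u a b d huz.symm hau.symm hab hbd haz.symm hbz.symm hub hud had.ne
  have h2 := hc.2 z u a d b huz.symm hau.symm had hbd.symm haz.symm hdz.symm hud hub hab.ne
  rw [Sym2.eq_swap (a := z), Sym2.eq_swap (a := u) (b := a)] at h1 h2
  rw [Sym2.eq_swap (a := d) (b := b)] at h2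
  exact ⟨fun h' ↦ h1 ⟨h', h⟩, fun h' ↦ h2 ⟨h', h⟩⟩

/-- If the three edges leaving a triangle `a b d` have the same color, there are at least five
colors. -/
theorem IsStarEdgeColoring.five_le_of_eq_pendant {V : Type*} {G : SimpleGraph V} {k : ℕ}
    {c : Sym2 V → Fin k} (hc : IsStarEdgeColoring G c) {a b d u ub ud x y : V} (hab : G.Adj a b)
    (had : G.Adj a d) (hbd : b ≠ d) (hau : G.Adj a u) (hbub : G.Adj b ub) (hdud : G.Adj d ud)
    (hux : G.Adj u x) (huy : G.Adj u y)
    (hub : u ≠ b) (hud : u ≠ d) (hxy : x ≠ y) (hax : a ≠ x) (hay : a ≠ y)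
    (hbx : b ≠ x) (hby : b ≠ y) (hdx : d ≠ x) (hdy : d ≠ y)
    (huub : u ≠ ub) (huud : u ≠ ud) (haub : a ≠ ub) (haud : a ≠ ud)
    (h1 : c s(a, u) = c s(b, ub)) (h2 : c s(a, u) = c s(d, ud)) : 5 ≤ k := by
  refine hc.five_le_of_avoid hab had hau hux huy hbd hub hud hxy hax hay fun z hz ↦ ?_
  have huz : G.Adj u z := by rcases hz with rfl | rfl <;> assumption
  have haz : a ≠ z := by rcases hz with rfl | rfl <;> assumption
  have hbz : b ≠ z := by rcases hz with rfl | rfl <;> assumption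
  have hdz : d ≠ z := by rcases hz with rfl | rfl <;> assumption
  have h3 := hc.2 z u a b ub huz.symm hau.symm hab hbub haz.symm hbz.symm hub huub haub
  have h4 := hc.2 z u a d ud huz.symm hau.symm had hdud haz.symm hdz.symm hud huud haud
  rw [Sym2.eq_swap (a := z), Sym2.eq_swap (a := u) (b := a)] at h3 h4
  exact ⟨fun h' ↦ h3 ⟨h', h1⟩, fun h' ↦ h4 ⟨h', h2⟩⟩

theorem natCast_ne_zero_of_lt {m a : ℕ} (h0 : 0 < a) (h : a < m) : (a : ZMod m) ≠ 0 := by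
  rw [Ne, ZMod.natCast_eq_zero_iff]
  exact Nat.not_dvd_of_pos_of_lt h0 h

theorem three_mul_cast (n : ℕ) : (n : ZMod (3 * n)) + n + n = 0 := by
  have h := ZMod.natCast_self (3 * n)
  push_cast at h
  linear_combination h

theorem five_le_of_isStarEdgeColoring_genPetersen {n k : ℕ} (hn : 2 ≤ n)
    {c : Sym2 (ZMod (3 * n) ⊕ ZMod (3 * n)) → Fin k}
    (hc : IsStarEdgeColoring (genPetersen (3 * n) n) c) : 5 ≤ k := by
  have h3 := three_mul_cast n
  have e1 : (1 : ZMod (3 * n)) ≠ 0 := by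
    exact_mod_cast natCast_ne_zero_of_lt (m := 3 * n) (a := 1) (by omega) (by omega)
  have e2 : (2 : ZMod (3 * n)) ≠ 0 := by
    exact_mod_cast natCast_ne_zero_of_lt (m := 3 * n) (a := 2) (by omega) (by omega)
  have en : (n : ZMod (3 * n)) ≠ 0 := natCast_ne_zero_of_lt (by omega) (by omega)
  have adju := genPetersen_adj_inl (n := n) e1
  have adjv := genPetersen_adj_inr en
  have tri (i : ZMod (3 * n)) :
      (genPetersen (3 * n) n).Adj (inr (i + n)) (inr (i - n)) := by
    rw [adjv]; left; congr 1; linear_combination -h3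
  by_contra hk
  have opp (i j l : ZMod (3 * n)) (hij : (genPetersen (3 * n) n).Adj (inr i) (inr j))
      (hil : (genPetersen (3 * n) n).Adj (inr i) (inr l))
      (hjl : (genPetersen (3 * n) n).Adj (inr j) (inr l)) :
      c s(inr i, inl i) ≠ c s(inr j, inr l) := by
    intro h
    refine hk (hc.five_le_of_eq_opposite (u := inl i) (x := inl (i + 1)) (y := inl (i - 1))
      hij hil hjl ?_ ?_ ?_ ?_ ?_ ?_ ?_ ?_ ?_ ?_ ?_ ?_ h) <;> simp [adju, adjv]
    grind
  have pend (i j l : ZMod (3 * n)) (hij : (genPetersen (3 * n) n).Adj (inr i) (inr j))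
      (hil : (genPetersen (3 * n) n).Adj (inr i) (inr l))
      (hjl : (genPetersen (3 * n) n).Adj (inr j) (inr l)) :
      c s(inr i, inl i) = c s(inr j, inl j) := by
    by_contra h
    have h1 := opp i j l hij hil hjl
    have h2 := opp j i l hij.symm hjl hil
    have h4 := hc.1 hij.symm (w := inl j) (by simp [adjv]) (by simp)
    rw [Sym2.eq_swap (a := inr j) (b := inr i)] at h4
    exact hk (five_le_of_ne (hc.1 hij hil (by simpa using hjl.ne))
      (by have := hc.1 hij.symm hjl (by simpa using hil.ne)
          rwa [Sym2.eq_swap (a := inr j) (b := inr i)] at this)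
      (hc.1 hij (w := inl i) (by simp [adjv]) (by simp)) h4
      (by have := hc.1 hil.symm hjl.symm (by simpa using hij.ne)
          rwa [Sym2.eq_swap (a := inr l) (b := inr i), Sym2.eq_swap (a := inr l) (b := inr j)]
            at this)
      (hc.1 hil (w := inl i) (by simp [adjv]) (by simp)) h2.symm h1.symm
      (hc.1 hjl (w := inl j) (by simp [adjv]) (by simp)) h)
  have a1 : (genPetersen (3 * n) n).Adj (inr 0) (inr (0 + n)) := by simp [adjv]
  have a2 : (genPetersen (3 * n) n).Adj (inr 0) (inr (0 - n)) := by simp [adjv]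
  have a3 := tri 0
  refine hk (hc.five_le_of_eq_pendant (u := inl 0) (x := inl (0 + 1)) (y := inl (0 - 1)) a1 a2
    a3.ne ?_ ?_ ?_ ?_ ?_ ?_ ?_ ?_ ?_ ?_ ?_ ?_ ?_ ?_ ?_ ?_ ?_ ?_
    (pend _ _ _ a1 a2 a3) (pend _ _ _ a2 a1 a3.symm)) <;> simp [adju, adjv]
  all_goals grind

/-! ### Upper bound -/

/-- No four consecutive edges with colors `x`, `a`, `b`, `y` alternate, for `x` in `l` and `y` in
`r`. -/
def NoAlternation {α : Type*} (l : List α) (a b : α) (r : List α) : Prop :=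
  ∀ x ∈ l, ∀ y ∈ r, ¬(x = b ∧ a = y)

instance {α : Type*} [DecidableEq α] (l : List α) (a b : α) (r : List α) :
    Decidable (NoAlternation l a b r) :=
  inferInstanceAs (Decidable (∀ x ∈ l, ∀ y ∈ r, ¬(x = b ∧ a = y)))

/-- The conditions on a star edge-coloring of a generalized Petersen graph `P(3n, n)` around the
vertices `uᵢ` and `vᵢ`: here `e₀`, `e₁`, `e₂`, `e₃` are the colors of `uⱼ uⱼ₊₁` for `j` from `i - 2`
to `i + 1`, `s₁`, `s₂`, `s₃` are those of `uⱼ vⱼ` for `j` from `i - 1` to `i + 1`, and `s₂`, `sp`,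
`sm` (`t`, `tp`, `tm`) are those of `uⱼ vⱼ` (`vⱼ vⱼ₊ₙ`) for `j = i`, `i + n`, `i - n`. -/
def LocalStar {α : Type*} (e₀ e₁ e₂ e₃ s₁ s₂ s₃ sp sm t tp tm : α) : Prop :=
  (e₁ ≠ e₂ ∧ e₁ ≠ s₂ ∧ e₂ ≠ s₂ ∧ t ≠ tm ∧ t ≠ s₂ ∧ tm ≠ s₂) ∧
  NoAlternation [e₀, s₁] e₁ e₂ [e₃, s₃] ∧ NoAlternation [e₀, s₁] e₁ s₂ [t, tm] ∧
  NoAlternation [t, tm] s₂ e₂ [e₃, s₃] ∧ NoAlternation [e₁, e₂] s₂ t [sp, tp] ∧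
  NoAlternation [e₁, e₂] s₂ tm [sm, tp] ∧ NoAlternation [sp] t tm [sm]

instance {α : Type*} [DecidableEq α] (e₀ e₁ e₂ e₃ s₁ s₂ s₃ sp sm t tp tm : α) :
    Decidable (LocalStar e₀ e₁ e₂ e₃ s₁ s₂ s₃ sp sm t tp tm) := by
  unfold LocalStar; infer_instance

/-- The edge coloring of `P(m, n)` with prescribed colors `E i`, `S i`, `T i` of the edges
`uᵢ uᵢ₊₁`, `uᵢ vᵢ`, `vᵢ vᵢ₊ₙ`. -/
theorem exists_edgeColoring {m n k : ℕ} [NeZero k] (h2 : (2 : ZMod m) ≠ 0)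
    (hn : (n : ZMod m) + n ≠ 0) (E S T : ZMod m → Fin k) :
    ∃ c : Sym2 (ZMod m ⊕ ZMod m) → Fin k, (∀ i, c s(inl i, inl (i + 1)) = E i) ∧
      (∀ i, c s(inl i, inr i) = S i) ∧ ∀ i, c s(inr i, inr (i + n)) = T i := by
  classical
  refine ⟨Sym2.lift ⟨fun
    | inl i, inl j => if j = i + 1 then E i else if i = j + 1 then E j else 0
    | inl i, inr _ => S i
    | inr _, inl j => S j
    | inr i, inr j => if j = i + n then T i else if i = j + n then T j else 0, ?_⟩, ?_, ?_, ?_⟩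
  · have := h2
    rintro (i | i) (j | j) <;> grind
  all_goals simp

set_option maxHeartbeats 1000000 in
theorem isStarEdgeColoring_of_localStar {n k : ℕ} (hn : 2 ≤ n)
    {c : Sym2 (ZMod (3 * n) ⊕ ZMod (3 * n)) → Fin k} {E S T : ZMod (3 * n) → Fin k}
    (hE : ∀ i, c s(inl i, inl (i + 1)) = E i) (hS : ∀ i, c s(inl i, inr i) = S i)
    (hT : ∀ i, c s(inr i, inr (i + n)) = T i)
    (h : ∀ i, LocalStar (E (i - 1 - 1)) (E (i - 1)) (E i) (E (i + 1)) (S (i - 1)) (S i) (S (i + 1))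
      (S (i + n)) (S (i - n)) (T i) (T (i + n)) (T (i - n))) :
    IsStarEdgeColoring (genPetersen (3 * n) n) c := by
  have h3 := three_mul_cast n
  have e1 : (1 : ZMod (3 * n)) ≠ 0 := by
    exact_mod_cast natCast_ne_zero_of_lt (m := 3 * n) (a := 1) (by omega) (by omega)
  have en : (n : ZMod (3 * n)) ≠ 0 := natCast_ne_zero_of_lt (by omega) (by omega)
  have adju := genPetersen_adj_inl (n := n) e1
  have adjv := genPetersen_adj_inr en
  have hE' (i) : c s(inl i, inl (i - 1)) = E (i - 1) := by
    rw [Sym2.eq_swap, ← hE, sub_add_cancel]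
  have hS' (i) : c s(inr i, inl i) = S i := by rw [Sym2.eq_swap, hS]
  have hT' (i) : c s(inr i, inr (i - n)) = T (i - n) := by
    rw [Sym2.eq_swap, ← hT, sub_add_cancel]
  have hnn (i : ZMod (3 * n)) : i + n + n = i - n := by linear_combination h3
  have hmm (i : ZMod (3 * n)) : i - n - n = i + n := by linear_combination -h3
  refine ⟨?_, ?_⟩
  · rintro (i | i) v w hv hw hvw
    all_goals
      simp only [adju, adjv] at hv hw
      have hi := (h i).1
      rcases hv with rfl | rfl | rfl <;> rcases hw with rfl | rfl | rfl <;>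
        simp only [hE, hE', hS, hS', hT, hT'] <;> grind
  · intro v₀ v₁ v₂ v₃ v₄ h01 h12 h23 h34 h02 h03 h13 h14 h24
    rw [Sym2.eq_swap (a := v₀), Sym2.eq_swap (a := v₁) (b := v₂)]
    replace h01 := h01.symm
    replace h12 := h12.symm
    rcases v₂ with i | i
    all_goals
      have hi := h i
      simp only [LocalStar, NoAlternation, List.forall_mem_cons, List.not_mem_nil, false_imp_iff,
        implies_true, and_true] at hi
      simp only [adju, adjv] at h12 h23
      rcases h12 with rfl | rfl | rfl <;> rcases h23 with rfl | rfl | rfl <;>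
        first
        | exact absurd rfl h13
        | simp only [adju, adjv] at h01 h34
          rcases h01 with rfl | rfl | rfl <;> rcases h34 with rfl | rfl | rfl <;>
            simp only [hE, hE', hS, hS', hT, hT'] <;>
            simp only [hnn, hmm, add_sub_cancel_right, sub_add_cancel, ne_eq,
              not_true_eq_false] at h02 h03 h14 h24 ⊢ <;>
            clear h h3 adju adjv hE hS hT hE' hS' hT' hnn hmm <;> grind

/-- The color patterns of the columns of `P(3n, n)`: `tableE a l` is the color of `uⱼ uⱼ₊₁`,
where `j` lies in layer `l` of a column of type `a`. -/
def tableE (a : ℕ) (l : ZMod 3) : Fin 5 :=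
  [2, 4, 0, 4, 1, 1, 0, 3, 4, 4, 0, 1, 3, 4, 0, 2, 4, 2, 0, 0, 1, 3, 1, 0, 0, 4, 1].getD
    (3 * a + l.val) 0

/-- `tableS a l` is the color of `uⱼ vⱼ`, where `j` lies in layer `l` of a column of type `a`. -/
def tableS (a : ℕ) (l : ZMod 3) : Fin 5 :=
  [3, 2, 2, 3, 2, 2, 1, 4, 0, 2, 2, 3, 1, 1, 2, 4, 2, 1, 4, 2, 4, 1, 3, 3, 1, 0, 2].getD
    (3 * a + l.val) 0

/-- `tableT a l` is the color of `vⱼ vⱼ₊ₙ`, where `j` lies in layer `l` of a column of type `a`. -/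
def tableT (a : ℕ) (l : ZMod 3) : Fin 5 :=
  [0, 1, 4, 0, 3, 1, 0, 2, 3, 1, 0, 4, 2, 3, 4, 1, 0, 3, 0, 1, 3, 0, 2, 4, 2, 3, 4].getD
    (3 * a + l.val) 0

/-- The types of columns that may follow a column of type `a`, with the shift of the layers. -/
def nextColumns : ℕ → List (ℕ × ZMod 3)
  | 0 => [(1, 0)]
  | 1 => [(2, 0)]
  | 2 => [(0, 0), (0, 1), (3, 0), (5, 0)]
  | 3 => [(4, 0)]
  | 4 => [(0, 1), (3, 1)]
  | 5 => [(6, 0)]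
  | 6 => [(7, 0)]
  | 7 => [(8, 0)]
  | 8 => [(0, 1), (5, 1)]
  | _ => []

theorem localStar_table : ∀ a < 9, ∀ l : ZMod 3, ∀ b ∈ nextColumns a, ∀ c ∈ nextColumns b.1,
    ∀ d ∈ nextColumns c.1,
    LocalStar (tableE a l) (tableE b.1 (l + b.2)) (tableE c.1 (l + b.2 + c.2))
      (tableE d.1 (l + b.2 + c.2 + d.2)) (tableS b.1 (l + b.2)) (tableS c.1 (l + b.2 + c.2))
      (tableS d.1 (l + b.2 + c.2 + d.2)) (tableS c.1 (l + b.2 + c.2 + 1))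
      (tableS c.1 (l + b.2 + c.2 - 1)) (tableT c.1 (l + b.2 + c.2))
      (tableT c.1 (l + b.2 + c.2 + 1)) (tableT c.1 (l + b.2 + c.2 - 1)) := by
  decide +kernel

/-- The type of the `j`-th of `n` columns: types `0, 1, 2` repeat periodically, followed by a final
block of types `3, 4` or `5, 6, 7, 8` if `n` is not divisible by three. -/
def columnType (n j : ℕ) : ℕ :=
  if n % 3 = 0 then j % 3
  else if n % 3 = 2 then if j + 2 < n then j % 3 else j + 5 - n
  else if j + 4 < n then j % 3 else j + 9 - n

theorem columnType_lt {n j : ℕ} (hj : j < n) : columnType n j < 9 := by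
  unfold columnType; split_ifs <;> omega

theorem mem_nextColumns_columnType {n j : ℕ} (hj : j + 1 < n) :
    (columnType n (j + 1), 0) ∈ nextColumns (columnType n j) := by
  have key : ∀ a < 9, ∀ b < 9, (b = a + 1 ∧ a ≠ 2 ∧ a ≠ 4 ∧ a ≠ 8) ∨
      (a = 2 ∧ (b = 0 ∨ b = 3 ∨ b = 5)) → (b, 0) ∈ nextColumns a := by
    intro a ha b hb h
    interval_cases a <;> interval_cases b <;> first | omega | decide
  refine key _ (columnType_lt (by omega)) _ (columnType_lt hj) ?_
  unfold columnType; split_ifs <;> omega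

theorem mem_nextColumns_columnType_last {n : ℕ} (hn : 2 ≤ n) :
    (columnType n 0, 1) ∈ nextColumns (columnType n (n - 1)) := by
  have key : ∀ a < 9, ∀ b < 9, (b = 0 ∧ (a = 2 ∨ a = 4 ∨ a = 8)) ∨ (a = 4 ∧ b = 3) ∨
      (a = 8 ∧ b = 5) → (b, 1) ∈ nextColumns a := by
    intro a ha b hb h
    interval_cases a <;> interval_cases b <;> first | omega | decide
  refine key _ (columnType_lt (by omega)) _ (columnType_lt (by omega)) ?_
  unfold columnType; split_ifs <;> omega

/-- The index `i` lies in column `i.val % n` and layer `i.val / n`. -/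
def layer (n : ℕ) (i : ZMod (3 * n)) : ZMod 3 := (i.val / n : ℕ)

theorem val_natCast_mod (n x : ℕ) : (x : ZMod (3 * n)).val % n = x % n := by
  rw [ZMod.val_natCast, Nat.mod_mod_of_dvd _ (dvd_mul_left n 3)]

theorem layer_natCast (n x : ℕ) : layer n x = (x / n : ℕ) := by
  rw [layer, ZMod.val_natCast, Nat.mod_mul_left_div_self, ZMod.natCast_mod]

theorem exists_mem_nextColumns {n : ℕ} (hn : 2 ≤ n) (i : ZMod (3 * n)) :
    ∃ b ∈ nextColumns (columnType n (i.val % n)),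
      columnType n ((i + 1).val % n) = b.1 ∧ layer n (i + 1) = layer n i + b.2 := by
  have : NeZero (3 * n) := ⟨by omega⟩
  obtain ⟨x, rfl⟩ : ∃ x : ℕ, (x : ZMod (3 * n)) = i := ⟨i.val, ZMod.natCast_zmod_val i⟩
  have hx : ((x : ZMod (3 * n)) + 1) = ((x + 1 : ℕ) : ZMod (3 * n)) := by push_cast; rfl
  simp only [hx, val_natCast_mod, layer_natCast]
  have hlt := Nat.mod_lt x (show 0 < n by omega)
  have hdiv := Nat.div_add_mod x n
  obtain h | h : x % n + 1 < n ∨ x % n = n - 1 := by omega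
  · have h1 : x + 1 = x % n + 1 + n * (x / n) := by omega
    refine ⟨_, mem_nextColumns_columnType h, ?_, ?_⟩
    · rw [h1, Nat.add_mul_mod_self_left, Nat.mod_eq_of_lt h]
    · rw [h1, Nat.add_mul_div_left _ _ (by omega), Nat.div_eq_of_lt h]
      simp
  · have h1 : x + 1 = 0 + n * (x / n + 1) := by rw [mul_add]; omega
    rw [h]
    refine ⟨_, mem_nextColumns_columnType_last hn, ?_, ?_⟩
    · rw [h1, Nat.add_mul_mod_self_left, Nat.zero_mod]
    · rw [h1, Nat.add_mul_div_left _ _ (by omega), Nat.zero_div]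
      simp

theorem column_add {n : ℕ} (hn : 2 ≤ n) (i : ZMod (3 * n)) :
    (i + n).val % n = i.val % n ∧ layer n (i + n) = layer n i + 1 := by
  have : NeZero (3 * n) := ⟨by omega⟩
  obtain ⟨x, rfl⟩ : ∃ x : ℕ, (x : ZMod (3 * n)) = i := ⟨i.val, ZMod.natCast_zmod_val i⟩
  rw [← Nat.cast_add]
  simp only [val_natCast_mod, layer_natCast, Nat.add_mod_right,
    Nat.add_div_right _ (show 0 < n by omega)]
  simp

theorem exists_isStarEdgeColoring_genPetersen {n : ℕ} (hn : 2 ≤ n) :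
    ∃ c : Sym2 (ZMod (3 * n) ⊕ ZMod (3 * n)) → Fin 5,
      IsStarEdgeColoring (genPetersen (3 * n) n) c := by
  have h3 := three_mul_cast n
  have e2 : (2 : ZMod (3 * n)) ≠ 0 := by
    exact_mod_cast natCast_ne_zero_of_lt (m := 3 * n) (a := 2) (by omega) (by omega)
  have en : (n : ZMod (3 * n)) + n ≠ 0 := by
    exact_mod_cast natCast_ne_zero_of_lt (m := 3 * n) (a := n + n) (by omega) (by omega)
  obtain ⟨c, hE, hS, hT⟩ := exists_edgeColoring e2 en
    (fun i ↦ tableE (columnType n (i.val % n)) (layer n i))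
    (fun i ↦ tableS (columnType n (i.val % n)) (layer n i))
    (fun i ↦ tableT (columnType n (i.val % n)) (layer n i))
  refine ⟨c, isStarEdgeColoring_of_localStar hn hE hS hT fun i ↦ ?_⟩
  obtain ⟨x, hx, hx1, hx2⟩ := exists_mem_nextColumns hn (i - 1 - 1)
  obtain ⟨y, hy, hy1, hy2⟩ := exists_mem_nextColumns hn (i - 1)
  obtain ⟨z, hz, hz1, hz2⟩ := exists_mem_nextColumns hn i
  obtain ⟨p1, p2⟩ := column_add hn i
  obtain ⟨q1, q2⟩ := column_add hn (i - n)
  rw [sub_add_cancel] at hx1 hx2 hy1 hy2 q1 q2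
  rw [hx1] at hy
  rw [hy1] at hz
  have key := localStar_table _ (columnType_lt (Nat.mod_lt _ (by omega)))
    (layer n (i - 1 - 1)) x hx y hy z hz
  simp only [p1, ← q1, p2, eq_sub_of_add_eq q2.symm, hz1, hz2, hy1, hy2, hx1, hx2]
  exact key

/-- For every `n ≥ 2`, the star chromatic index of the generalized Petersen
graph `P(3n, n)` equals 5. -/
theorem starChromaticIndex_genPetersen (n : ℕ) (hn : 2 ≤ n) :
    starChromaticIndex (genPetersen (3 * n) n) = 5 := by
  refine le_antisymm (Nat.sInf_le (exists_isStarEdgeColoring_genPetersen hn)) ?_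
  refine le_csInf ⟨5, exists_isStarEdgeColoring_genPetersen hn⟩ ?_
  rintro k ⟨c, hc⟩
  exact five_le_of_isStarEdgeColoring_genPetersen hn hc
end
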